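/- arXiv:math/0601247 — 2 statements merged into one kernel-verified Lean document; each statement's English description precedes it below -/
import Mathlib

section
/- Assume (A3). Two lines A and B of SA(p,K) are parallel if and only if there exists φ ∈ Δ with φ(A) = B such that φ is the identity or has no fixed point in P ∖ p̄. -/
/-- A Laguerre plane: points, circles, and a parallelity relation. -/
structure LaguerrePlane (P : Type*) where
  Circles : Set (Set P)
  Par : P → P → Prop
  par_equiv : Equivalence Par
  joinCircle : ∀ a b c : P, ¬ Par a b → ¬ Par b c → ¬ Par a c →
    ∃! C, C ∈ Circles ∧ a ∈ C ∧ b ∈ C ∧ c ∈ C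
  touching : ∀ K ∈ Circles, ∀ p ∈ K, ∀ q, q ∉ K → ¬ Par p q →
    ∃! C, C ∈ Circles ∧ q ∈ C ∧ K ∩ C = {p}
  parPoint : ∀ (x : P), ∀ K ∈ Circles, ∃! q, Par x q ∧ q ∈ K
  nontriv : ∃ C ∈ Circles,
    (∃ a b c : P, a ∈ C ∧ b ∈ C ∧ c ∈ C ∧ a ≠ b ∧ b ≠ c ∧ a ≠ c) ∧ C ≠ Set.univ

namespace LaguerrePlane

variable {P : Type*}

/-- The generator (parallel class) of a point. -/
def gen (L : LaguerrePlane P) (p : P) : Set P := {q | L.Par p q}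

/-- The pencil ⟨p,K⟩: the circle K together with all circles tangent to K at p. -/
def pencil (L : LaguerrePlane P) (p : P) (K : Set P) : Set (Set P) :=
  insert K {M | M ∈ L.Circles ∧ M ∩ K = {p}}

/-- An automorphism of a Laguerre plane: a bijection of the points mapping
circles onto circles and preserving parallelity. -/
def IsAut (L : LaguerrePlane P) (σ : Equiv.Perm P) : Prop :=
  (∀ C, C ∈ L.Circles ↔ ⇑σ '' C ∈ L.Circles) ∧
  (∀ x y, L.Par x y ↔ L.Par (σ x) (σ y))

/-- The line x ⊔ y of the residual plane SA(p,K):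
{x} together with the orbit of y under the stabilizer of x in Δ. -/
def line (Δ : Subgroup (Equiv.Perm P)) (x y : P) : Set P :=
  {x} ∪ {z | ∃ σ ∈ Δ, σ x = x ∧ σ y = z}

/-- Parallelity of lines of the residual plane SA(p,K). -/
def LinePar (Δ : Subgroup (Equiv.Perm P)) (A B : Set P) : Prop :=
  ∃ σ ∈ Δ, ⇑σ '' A = B

end LaguerrePlane

open LaguerrePlane

namespace LaguerrePlane

variable {P : Type*} {L : LaguerrePlane P} {p : P} {K : Set P} {Δ : Subgroup (Equiv.Perm P)}

theorem par_refl (L : LaguerrePlane P) (x : P) : L.Par x x := L.par_equiv.refl x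

theorem Par.symm {x y : P} (h : L.Par x y) : L.Par y x := L.par_equiv.symm h

theorem Par.trans {x y z : P} (h : L.Par x y) (h' : L.Par y z) : L.Par x z :=
  L.par_equiv.trans h h'

theorem eq_of_par_of_mem {C : Set P} (hC : C ∈ L.Circles) {x y : P} (hx : x ∈ C) (hy : y ∈ C)
    (h : L.Par x y) : x = y :=
  (L.parPoint x C hC).unique ⟨L.par_refl x, hx⟩ ⟨h, hy⟩

theorem circle_eq {C D : Set P} (hC : C ∈ L.Circles) (hD : D ∈ L.Circles) {x y z : P}
    (hxy : ¬ L.Par x y) (hyz : ¬ L.Par y z) (hxz : ¬ L.Par x z)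
    (hxC : x ∈ C) (hyC : y ∈ C) (hzC : z ∈ C) (hxD : x ∈ D) (hyD : y ∈ D) (hzD : z ∈ D) :
    C = D :=
  (L.joinCircle x y z hxy hyz hxz).unique ⟨hC, hxC, hyC, hzC⟩ ⟨hD, hxD, hyD, hzD⟩

theorem exists_not_par_not_par (L : LaguerrePlane P) (x y : P) :
    ∃ z, ¬ L.Par x z ∧ ¬ L.Par y z := by
  obtain ⟨C, hC, ⟨a, b, c, ha, hb, hc, hab, hbc, hac⟩, -⟩ := L.nontriv
  have key : ∀ w s t, s ∈ C → t ∈ C → s ≠ t → L.Par w s → ¬ L.Par w t :=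
    fun w s t hs ht hst h h' => hst (eq_of_par_of_mem hC hs ht (h.symm.trans h'))
  by_contra! H
  have h1 := key x a b ha hb hab
  have h2 := key x a c ha hc hac
  have h3 := key x b c hb hc hbc
  have h4 := key y a b ha hb hab
  have h5 := key y a c ha hc hac
  have h6 := key y b c hb hc hbc
  have := H a
  have := H b
  have := H c
  tauto

/-- A group of automorphisms which fixes the generator of `p` pointwise, preserves the pencil
of `p` and `K`, and has the transitivity properties (A1) and (A2). -/
structure IsPencilGroup (L : LaguerrePlane P) (p : P) (K : Set P)
    (Δ : Subgroup (Equiv.Perm P)) : Prop where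
  circle : K ∈ L.Circles
  mem : p ∈ K
  isAut : ∀ σ ∈ Δ, L.IsAut σ
  apply_eq : ∀ σ ∈ Δ, ∀ q, L.Par p q → σ q = q
  image_pencil : ∀ σ ∈ Δ, ∀ M ∈ L.pencil p K, ⇑σ '' M ∈ L.pencil p K
  transitive : ∀ x y : P, ¬ L.Par p x → ¬ L.Par p y → ∃ σ ∈ Δ, σ x = y
  transitive_stabilizer : ∀ r ∈ K, r ≠ p → ∀ x ∈ K, x ≠ p → x ≠ r → ∀ y ∈ K, y ≠ p → y ≠ r →
    ∃ σ ∈ Δ, σ r = r ∧ σ x = y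

theorem image_line_eq_of_apply_eq {φ σ : Equiv.Perm P} (hφ : φ ∈ Δ) (hσ : σ ∈ Δ) {a b : P}
    (h : φ a = σ a) : ⇑φ '' line Δ a b = ⇑σ '' line Δ a b := by
  have sub : ∀ φ ∈ Δ, ∀ σ ∈ Δ, φ a = σ a → ⇑φ '' line Δ a b ⊆ ⇑σ '' line Δ a b := by
    rintro φ hφ σ hσ h _ ⟨x, hx, rfl⟩
    refine ⟨σ⁻¹ (φ x), ?_, by simp⟩
    rcases hx with rfl | ⟨τ, hτ, hτa, rfl⟩
    · left
      simp [h]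
    · right
      exact ⟨σ⁻¹ * φ * τ, Δ.mul_mem (Δ.mul_mem (Δ.inv_mem hσ) hφ) hτ, by simp [hτa, h], by simp⟩
  exact (sub φ hφ σ hσ h).antisymm (sub σ hσ φ hφ h.symm)

namespace IsPencilGroup

theorem par_apply (hD : L.IsPencilGroup p K Δ) {σ : Equiv.Perm P} (hσ : σ ∈ Δ) {x y : P} :
    L.Par (σ x) (σ y) ↔ L.Par x y :=
  ((hD.isAut σ hσ).2 x y).symm

theorem image_circle (hD : L.IsPencilGroup p K Δ) {σ : Equiv.Perm P} (hσ : σ ∈ Δ) {C : Set P}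
    (hC : C ∈ L.Circles) : ⇑σ '' C ∈ L.Circles :=
  ((hD.isAut σ hσ).1 C).1 hC

theorem not_par_apply (hD : L.IsPencilGroup p K Δ) {σ : Equiv.Perm P} (hσ : σ ∈ Δ) {x : P}
    (hx : ¬ L.Par p x) : ¬ L.Par p (σ x) := by
  intro h
  rw [← hD.apply_eq σ hσ p (L.par_refl p), hD.par_apply hσ] at h
  exact hx h

theorem exists_mem_pencil (hD : L.IsPencilGroup p K Δ) {z : P} (hz : ¬ L.Par p z) :
    ∃ N ∈ L.pencil p K, z ∈ N := by
  by_cases h : z ∈ K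
  · exact ⟨K, Set.mem_insert _ _, h⟩
  · obtain ⟨N, ⟨hN, hzN, hKN⟩, -⟩ := L.touching K hD.circle p hD.mem z h hz
    exact ⟨N, Or.inr ⟨hN, by rwa [Set.inter_comm]⟩, hzN⟩

theorem pencil_circle (hD : L.IsPencilGroup p K Δ) {N : Set P} (hN : N ∈ L.pencil p K) :
    N ∈ L.Circles := by
  rcases hN with rfl | h
  exacts [hD.circle, h.1]

theorem mem_of_mem_pencil (hD : L.IsPencilGroup p K Δ) {N : Set P} (hN : N ∈ L.pencil p K) :
    p ∈ N := by
  rcases hN with rfl | h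
  · exact hD.mem
  · exact (h.2.symm ▸ Set.mem_singleton p : p ∈ N ∩ K).1

theorem pencil_eq (hD : L.IsPencilGroup p K Δ) {z : P} (hz : ¬ L.Par p z) {N N' : Set P}
    (hN : N ∈ L.pencil p K) (hN' : N' ∈ L.pencil p K) (hzN : z ∈ N) (hzN' : z ∈ N') :
    N = N' := by
  have off : ∀ M, M ∩ K = {p} → z ∈ M → z ∉ K := fun M hM hzM hzK =>
    hz ((show z = p from hM.subset ⟨hzM, hzK⟩) ▸ L.par_refl z)
  rcases hN with rfl | h <;> rcases hN' with rfl | h'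
  · rfl
  · exact absurd hzN (off _ h'.2 hzN')
  · exact absurd hzN' (off _ h.2 hzN)
  · refine (L.touching K hD.circle p hD.mem z (off _ h.2 hzN) hz).unique
      ⟨h.1, hzN, ?_⟩ ⟨h'.1, hzN', ?_⟩
    · rw [Set.inter_comm, h.2]
    · rw [Set.inter_comm, h'.2]

theorem image_pencil_eq (hD : L.IsPencilGroup p K Δ) {σ : Equiv.Perm P} (hσ : σ ∈ Δ) {z : P}
    (hz : ¬ L.Par p z) {N : Set P} (hN : N ∈ L.pencil p K) (hzN : z ∈ N) (hfix : σ z = z) :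
    ⇑σ '' N = N :=
  hD.pencil_eq hz (hD.image_pencil σ hσ N hN) hN ⟨z, hzN, hfix⟩ hzN

/-- A circle is preserved as soon as two nonparallel points of it, off the generator of `p`,
are images of points of it. -/
theorem image_circle_eq (hD : L.IsPencilGroup p K Δ) {σ : Equiv.Perm P} (hσ : σ ∈ Δ) {C : Set P}
    (hC : C ∈ L.Circles) {x y x' y' : P} (hx : x ∈ C) (hy : y ∈ C) (hx' : x' ∈ C) (hy' : y' ∈ C)
    (hxx : σ x' = x) (hyy : σ y' = y) (hpx : ¬ L.Par p x) (hpy : ¬ L.Par p y)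
    (hxy : ¬ L.Par x y) : ⇑σ '' C = C := by
  obtain ⟨m, ⟨hpm, hm⟩, -⟩ := L.parPoint p C hC
  exact circle_eq (hD.image_circle hσ hC) hC hxy (fun h => hpy (hpm.trans h.symm))
    (fun h => hpx (hpm.trans h.symm)) ⟨x', hx', hxx⟩ ⟨y', hy', hyy⟩
    ⟨m, hm, hD.apply_eq σ hσ m hpm⟩ hx hy hm

theorem exists_tangent_circle (hD : L.IsPencilGroup p K Δ) {z y : P} (hz : ¬ L.Par p z)
    (hzy : ¬ L.Par z y) :
    ∃ M ∈ L.Circles, z ∈ M ∧ y ∈ M ∧ ∀ σ ∈ Δ, σ z = z → ⇑σ '' M = M := by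
  obtain ⟨N, hN, hzN⟩ := hD.exists_mem_pencil hz
  have hNC := hD.pencil_circle hN
  by_cases hyN : y ∈ N
  · exact ⟨N, hNC, hzN, hyN, fun σ hσ h => hD.image_pencil_eq hσ hz hN hzN h⟩
  obtain ⟨M, ⟨hM, hyM, hNM⟩, -⟩ := L.touching N hNC z hzN y hyN hzy
  have hzM : z ∈ M := (hNM.symm ▸ Set.mem_singleton z : z ∈ N ∩ M).2
  refine ⟨M, hM, hzM, hyM, fun σ hσ h => ?_⟩
  obtain ⟨m, ⟨hpm, hm⟩, -⟩ := L.parPoint p M hM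
  have hzm : ¬ L.Par z m := fun h => hz (hpm.trans h.symm)
  have hmN : m ∉ N := fun h =>
    hzm ((show m = z from hNM.subset ⟨h, hm⟩) ▸ L.par_refl m)
  refine (L.touching N hNC z hzN m hmN hzm).unique
    ⟨hD.image_circle hσ hM, ⟨m, hm, hD.apply_eq σ hσ m hpm⟩, ?_⟩ ⟨hM, hm, hNM⟩
  rw [← hD.image_pencil_eq hσ hz hN hzN h, ← Set.image_inter σ.injective, hNM,
    Set.image_singleton, h]

theorem exists_par_ne (hD : L.IsPencilGroup p K Δ) : ∃ m, L.Par p m ∧ m ≠ p := by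
  obtain ⟨C, hC, -, hne⟩ := L.nontriv
  obtain ⟨q, hq⟩ := (Set.ne_univ_iff_exists_notMem C).1 hne
  obtain ⟨r, ⟨hqr, hr⟩, -⟩ := L.parPoint q C hC
  have hqr' : q ≠ r := fun h => hq (h ▸ hr)
  by_cases hpq : L.Par p q
  · by_cases h : q = p
    · exact ⟨r, hpq.trans hqr, fun h' => hqr' (h.trans h'.symm)⟩
    · exact ⟨q, hpq, h⟩
  obtain ⟨z, hpz, hqz⟩ := L.exists_not_par_not_par p q
  obtain ⟨N, hN, hzN⟩ := hD.exists_mem_pencil hpz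
  have hNC := hD.pencil_circle hN
  obtain ⟨s, hqs, hsN⟩ : ∃ s, L.Par q s ∧ s ∉ N := by
    by_cases hqN : q ∈ N
    · exact ⟨r, hqr, fun h => hqr' (eq_of_par_of_mem hNC hqN h hqr)⟩
    · exact ⟨q, L.par_refl q, hqN⟩
  obtain ⟨M, ⟨hM, -, hNM⟩, -⟩ :=
    L.touching N hNC z hzN s hsN (fun h => hqz (hqs.trans h.symm))
  obtain ⟨m, ⟨hpm, hm⟩, -⟩ := L.parPoint p M hM
  refine ⟨m, hpm, ?_⟩
  rintro rfl
  exact hpz ((show m = z from hNM.subset ⟨hD.mem_of_mem_pencil hN, hm⟩) ▸ L.par_refl m)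

theorem exists_par_notMem (hD : L.IsPencilGroup p K Δ) (v : P) {C : Set P}
    (hC : C ∈ L.Circles) : ∃ w, L.Par v w ∧ w ∉ C := by
  obtain ⟨m, hpm, hmp⟩ := hD.exists_par_ne
  obtain ⟨z, hpz, hvz⟩ := L.exists_not_par_not_par p v
  obtain ⟨N, hN, hzN⟩ := hD.exists_mem_pencil hpz
  have hNC := hD.pencil_circle hN
  have hmN : m ∉ N := fun h =>
    hmp (eq_of_par_of_mem hNC (hD.mem_of_mem_pencil hN) h hpm).symm
  obtain ⟨M, ⟨hM, -, hNM⟩, -⟩ :=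
    L.touching N hNC z hzN m hmN (fun h => hpz (hpm.trans h.symm))
  obtain ⟨s, ⟨hvs, hs⟩, -⟩ := L.parPoint v N hNC
  obtain ⟨t, ⟨hvt, ht⟩, -⟩ := L.parPoint v M hM
  by_cases hsC : s ∈ C
  · refine ⟨t, hvt, fun htC => hvz ?_⟩
    obtain rfl := eq_of_par_of_mem hC hsC htC (hvs.symm.trans hvt)
    exact (show s = z from hNM.subset ⟨hs, ht⟩) ▸ hvs
  · exact ⟨s, hvs, hsC⟩

theorem apply_eq_of_par (hD : L.IsPencilGroup p K Δ) {σ : Equiv.Perm P} (hσ : σ ∈ Δ) {z v : P}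
    (hz : ¬ L.Par p z) (hzv : ¬ L.Par z v) (hfix : σ z = z) (hv : L.Par v (σ v)) : σ v = v := by
  obtain ⟨M, hM, -, hvM, hinv⟩ := hD.exists_tangent_circle hz hzv
  exact (eq_of_par_of_mem hM hvM (hinv σ hσ hfix ▸ ⟨v, hvM, rfl⟩) hv).symm

theorem apply_mem_pencil (hD : L.IsPencilGroup p K Δ) {σ : Equiv.Perm P} (hσ : σ ∈ Δ) {z w : P}
    (hz : ¬ L.Par p z) (hfix : ∀ y, L.Par z y → σ y = y) {N : Set P} (hN : N ∈ L.pencil p K)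
    (hw : w ∈ N) : σ w ∈ N := by
  obtain ⟨y, ⟨hzy, hy⟩, -⟩ := L.parPoint z N (hD.pencil_circle hN)
  have h := hD.image_pencil_eq hσ (fun h => hz (h.trans hzy.symm)) hN hy (hfix y hzy)
  exact h ▸ ⟨w, hw, rfl⟩

theorem not_par_apply_of_fixed (hD : L.IsPencilGroup p K Δ) {σ : Equiv.Perm P} (hσ : σ ∈ Δ)
    {z w : P} (hz : ¬ L.Par p z) (hfix : ∀ y, L.Par z y → σ y = y) (hw : ¬ L.Par p w)
    (hne : σ w ≠ w) : ¬ L.Par w (σ w) := by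
  obtain ⟨N, hN, hwN⟩ := hD.exists_mem_pencil hw
  exact fun h => hne (eq_of_par_of_mem (hD.pencil_circle hN) hwN
    (hD.apply_mem_pencil hσ hz hfix hN hwN) h).symm

theorem eq_one_of_par (hD : L.IsPencilGroup p K Δ) {σ : Equiv.Perm P} (hσ : σ ∈ Δ) {z v : P}
    (hz : ¬ L.Par p z) (hv : ¬ L.Par p v) (hzv : ¬ L.Par z v) (hfix : σ z = z)
    (hvv : L.Par v (σ v)) : σ = 1 := by
  have hv' : ∀ y, L.Par v y → σ y = y := fun y hy =>
    hD.apply_eq_of_par hσ hz (fun h => hzv (h.trans hy.symm)) hfix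
      (hy.symm.trans (hvv.trans ((hD.par_apply hσ).2 hy)))
  have hfv := hv' v (L.par_refl v)
  have hz' : ∀ y, L.Par z y → σ y = y := fun y hy =>
    hD.apply_eq_of_par hσ hv (fun h => hzv (hy.trans h.symm)) hfv
      (hy.symm.trans ((hfix.symm ▸ L.par_refl z : L.Par z (σ z)).trans ((hD.par_apply hσ).2 hy)))
  ext w
  by_contra hw
  change σ w ≠ w at hw
  have hpw : ¬ L.Par p w := fun h => hw (hD.apply_eq σ hσ w h)
  have hzw : ¬ L.Par z w := fun h => hw (hz' w h)
  have hvw : ¬ L.Par v w := fun h => hw (hv' w h)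
  have hww := hD.not_par_apply_of_fixed hσ hz hz' hpw hw
  have hzw' : ¬ L.Par z (σ w) := fun h => hzw ((hD.par_apply hσ).1 (by rwa [hfix]))
  obtain ⟨C, ⟨hC, hzC, hwC, hwC'⟩, -⟩ := L.joinCircle z w (σ w) hzw hww hzw'
  obtain ⟨y, hvy, hyC⟩ := hD.exists_par_notMem v hC
  have hzy : ¬ L.Par z y := fun h => hzv (h.trans hvy.symm)
  obtain ⟨D, ⟨hDC, hzD, hwD, hyD⟩, -⟩ :=
    L.joinCircle z w y hzw (fun h => hvw (hvy.trans h.symm)) hzy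
  have hinv := hD.image_circle_eq hσ hDC hzD hyD hzD hyD hfix (hv' y hvy) hz
    (fun h => hv (h.trans hvy.symm)) hzy
  have hwD' : σ w ∈ D := hinv ▸ ⟨w, hwD, rfl⟩
  exact hyC (circle_eq hC hDC hzw hww hzw' hzC hwC hwC' hzD hwD hwD' ▸ hyD)

theorem exists_apply_eq_par (hD : L.IsPencilGroup p K Δ) {x y v w : P} (hx : ¬ L.Par p x)
    (hy : ¬ L.Par p y) (hv : ¬ L.Par p v) (hw : ¬ L.Par p w) (hxv : ¬ L.Par x v)
    (hyw : ¬ L.Par y w) : ∃ σ ∈ Δ, σ x = y ∧ L.Par w (σ v) := by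
  obtain ⟨r, ⟨hxr, hrK⟩, -⟩ := L.parPoint x K hD.circle
  have hpr : ¬ L.Par p r := fun h => hx (h.trans hxr.symm)
  have ne_of : ∀ {s t : P}, ¬ L.Par s t → t ≠ s := by
    rintro s _ h rfl
    exact h (L.par_refl _)
  obtain ⟨α, hα, hαx⟩ := hD.transitive x r hx hpr
  obtain ⟨β, hβ, hβy⟩ := hD.transitive y r hy hpr
  obtain ⟨s, ⟨hvs, hsK⟩, -⟩ := L.parPoint (α v) K hD.circle
  obtain ⟨t, ⟨hwt, htK⟩, -⟩ := L.parPoint (β w) K hD.circle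
  obtain ⟨τ, hτ, hτr, hτs⟩ := hD.transitive_stabilizer r hrK (ne_of hpr)
    s hsK (ne_of fun h => hD.not_par_apply hα hv (h.trans hvs.symm))
    (ne_of fun h => hxv ((hD.par_apply hα).1 (by rw [hαx]; exact h.trans hvs.symm)))
    t htK (ne_of fun h => hD.not_par_apply hβ hw (h.trans hwt.symm))
    (ne_of fun h => hyw ((hD.par_apply hβ).1 (by rw [hβy]; exact h.trans hwt.symm)))
  refine ⟨β⁻¹ * τ * α, Δ.mul_mem (Δ.mul_mem (Δ.inv_mem hβ) hτ) hα, ?_, ?_⟩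
  · rw [Equiv.Perm.mul_apply, Equiv.Perm.mul_apply, hαx, hτr, Equiv.Perm.inv_eq_iff_eq, hβy]
  · rw [← hD.par_apply hβ]
    have := (hD.par_apply hτ).2 hvs
    rw [hτs] at this
    simpa using hwt.trans this.symm

/-- An involution with a fixed point fixes the generator of that point pointwise. -/
theorem apply_eq_of_involution (hD : L.IsPencilGroup p K Δ) {σ : Equiv.Perm P} (hσ : σ ∈ Δ)
    (hinv : σ * σ = 1) (hne : σ ≠ 1) {z : P} (hz : ¬ L.Par p z) (hfix : σ z = z) :
    ∀ y, L.Par z y → σ y = y := by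
  intro y hy
  obtain ⟨w, hpw, hzw⟩ := L.exists_not_par_not_par p z
  have hpw' := hD.not_par_apply hσ hpw
  have hww : ¬ L.Par w (σ w) := fun h => hne (hD.eq_one_of_par hσ hz hpw hzw hfix h)
  have hzw' : ¬ L.Par z (σ w) := fun h => hzw ((hD.par_apply hσ).1 (by rwa [hfix]))
  have hσσ : σ (σ w) = w := by rw [← Equiv.Perm.mul_apply, hinv, Equiv.Perm.one_apply]
  obtain ⟨C, ⟨hC, hyC, hwC, hwC'⟩, -⟩ := L.joinCircle y w (σ w)
    (fun h => hzw (hy.trans h)) hww (fun h => hzw' (hy.trans h))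
  have hCC := hD.image_circle_eq hσ hC hwC hwC' hwC' hwC hσσ rfl hpw hpw' hww
  refine eq_of_par_of_mem hC (hCC ▸ ⟨y, hyC, rfl⟩) hyC ?_
  have h := (hD.par_apply hσ).2 hy
  rw [hfix] at h
  exact h.symm.trans hy

/-- The product of two involutions which fix points of distinct generators has no fixed point. -/
theorem mul_apply_ne_of_involutions (hD : L.IsPencilGroup p K Δ) {σ τ : Equiv.Perm P}
    (hσ : σ ∈ Δ) (hτ : τ ∈ Δ) (hσσ : σ * σ = 1) (hττ : τ * τ = 1) (hσ1 : σ ≠ 1) (hτ1 : τ ≠ 1)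
    {z x : P} (hz : ¬ L.Par p z) (hx : ¬ L.Par p x) (hzx : ¬ L.Par z x) (hσz : σ z = z)
    (hτx : τ x = x) {q : P} (hq : ¬ L.Par p q) : (σ * τ) q ≠ q := by
  intro h
  have hz' := hD.apply_eq_of_involution hσ hσσ hσ1 hz hσz
  have hinvσ : ∀ y, σ (σ y) = y := fun y => by
    rw [← Equiv.Perm.mul_apply, hσσ, Equiv.Perm.one_apply]
  have hinvτ : ∀ y, τ (τ y) = y := fun y => by
    rw [← Equiv.Perm.mul_apply, hττ, Equiv.Perm.one_apply]
  have hστ : σ q = τ q := by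
    rw [Equiv.Perm.mul_apply] at h
    rw [← hinvσ (τ q), h]
  by_cases hqq : σ q = q
  · have hzq : L.Par z q := by
      by_contra hzq
      exact hσ1 (hD.eq_one_of_par hσ hz hq hzq hσz (hqq.symm ▸ L.par_refl q))
    exact hτ1 (hD.eq_one_of_par hτ hx hq (fun h' => hzx (hzq.trans h'.symm)) hτx
      ((hστ.symm.trans hqq).symm ▸ L.par_refl q))
  · have hpar := hD.not_par_apply_of_fixed hσ hz hz' hq hqq
    have h1 : σ * τ = 1 := by
      refine hD.eq_one_of_par (Δ.mul_mem hσ hτ) hq (hD.not_par_apply hσ hq) hpar h ?_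
      rw [Equiv.Perm.mul_apply, hστ, hinvτ, hστ]
      exact L.par_refl _
    have h2 : σ x = x := by
      have := Equiv.congr_fun h1 x
      rwa [Equiv.Perm.mul_apply, hτx] at this
    exact hσ1 (hD.eq_one_of_par hσ hz hx hzx hσz (h2.symm ▸ L.par_refl x))

/-- The translations act transitively on the points off the generator of `p`. -/
theorem exists_translation (hD : L.IsPencilGroup p K Δ) {x y : P} (hx : ¬ L.Par p x)
    (hy : ¬ L.Par p y) :
    ∃ φ ∈ Δ, φ x = y ∧ (φ = 1 ∨ ∀ z : P, ¬ L.Par p z → φ z ≠ z) := by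
  by_cases hxy : L.Par x y
  · obtain ⟨v, hpv, hxv⟩ := L.exists_not_par_not_par p x
    obtain ⟨σ, hσ, hσx, hσv⟩ := hD.exists_apply_eq_par hx hy hpv hpv hxv
      (fun h => hxv (hxy.trans h))
    refine ⟨σ, hσ, hσx, or_iff_not_imp_left.2 fun hne z hz hfix => hne ?_⟩
    by_cases hzv : L.Par z v
    · exact hD.eq_one_of_par hσ hz hx (fun h => hxv (h.symm.trans hzv)) hfix (hσx.symm ▸ hxy)
    · exact hD.eq_one_of_par hσ hz hpv hzv hfix hσv
  obtain ⟨σ, hσ, hσx, hσy⟩ := hD.exists_apply_eq_par hx hy hy hx hxy (fun h => hxy h.symm)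
  by_cases hfree : ∀ z : P, ¬ L.Par p z → σ z ≠ z
  · exact ⟨σ, hσ, hσx, Or.inr hfree⟩
  push Not at hfree
  obtain ⟨z, hz, hσz⟩ := hfree
  have hzx : ¬ L.Par z x := fun h => by
    have h' := (hD.par_apply hσ).2 h
    rw [hσz, hσx] at h'
    exact hxy (h.symm.trans h')
  have hσσ : σ * σ = 1 := hD.eq_one_of_par (Δ.mul_mem hσ hσ) hz hx hzx
    (by rw [Equiv.Perm.mul_apply, hσz, hσz]) (by rwa [Equiv.Perm.mul_apply, hσx])
  have hσ1 : σ ≠ 1 := by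
    rintro rfl
    exact hxy (hσx ▸ L.par_refl _)
  obtain ⟨g, hg, hgz⟩ := hD.transitive z x hz hx
  have hτx : (g * σ * g⁻¹) x = x := by simp [← hgz, hσz]
  have hτ : g * σ * g⁻¹ ∈ Δ := Δ.mul_mem (Δ.mul_mem hg hσ) (Δ.inv_mem hg)
  have hττ : g * σ * g⁻¹ * (g * σ * g⁻¹) = 1 := by
    rw [conj_mul, hσσ, mul_one, mul_inv_cancel]
  have hτ1 : g * σ * g⁻¹ ≠ 1 := fun h => hσ1 (conj_eq_one_iff.1 h)
  exact ⟨σ * (g * σ * g⁻¹), Δ.mul_mem hσ hτ, by rw [Equiv.Perm.mul_apply, hτx, hσx],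
    Or.inr fun q hq =>
      hD.mul_apply_ne_of_involutions hσ hτ hσσ hττ hσ1 hτ1 hz hx hzx hσz hτx hq⟩

end IsPencilGroup

end LaguerrePlane

/-- assume (A3).  Two lines of SA(p,K) are parallel iff some
φ ∈ Δ which is the identity or has no fixed point in P ∖ p̄ (a translation)
maps one onto the other. -/
theorem parallel_iff_translation
    {P : Type*} (L : LaguerrePlane P) (p : P) (K : Set P)
    (Δ : Subgroup (Equiv.Perm P))
    (hK : K ∈ L.Circles) (hpK : p ∈ K)
    (haut : ∀ σ ∈ Δ, L.IsAut σ)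
    (hfix : ∀ σ ∈ Δ, ∀ q, L.Par p q → σ q = q)
    (hpen : ∀ σ ∈ Δ, ∀ M ∈ L.pencil p K, ⇑σ '' M ∈ L.pencil p K)
    (hA1 : ∀ x y : P, ¬ L.Par p x → ¬ L.Par p y → ∃ σ ∈ Δ, σ x = y)
    (hA2 : ∀ r ∈ K, r ≠ p → ∀ x ∈ K, x ≠ p → x ≠ r → ∀ y ∈ K, y ≠ p → y ≠ r →
      ∃ σ ∈ Δ, σ r = r ∧ σ x = y)    (hA3 : ∀ M ∈ L.Circles, p ∉ M → ∃! N, N ∈ L.pencil p K ∧ ∃ z, M ∩ N = {z})    :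
    ∀ a b a' b' : P, ¬ L.Par p a → ¬ L.Par p b → ¬ L.Par p a' → ¬ L.Par p b' →
    a ≠ b → a' ≠ b' →
    (LinePar Δ (line Δ a b) (line Δ a' b') ↔
      ∃ φ ∈ Δ, (φ = 1 ∨ ∀ z : P, ¬ L.Par p z → φ z ≠ z) ∧
        ⇑φ '' line Δ a b = line Δ a' b') := by
  have hD : L.IsPencilGroup p K Δ := ⟨hK, hpK, haut, hfix, hpen, hA1, hA2⟩
  intro a b a' b' ha _ _ _ _ _
  constructor
  · rintro ⟨σ, hσ, hAB⟩
    obtain ⟨φ, hφ, hφa, hfp⟩ := hD.exists_translation ha (hD.not_par_apply hσ ha)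
    refine ⟨φ, hφ, hfp, ?_⟩
    rw [← hAB]
    exact image_line_eq_of_apply_eq hφ hσ hφa
  · rintro ⟨φ, hφ, -, h⟩
    exact ⟨φ, hφ, h⟩
end

section
/- Assume (A3). Let L ∈ ⟨p,K⟩ and let M, N be circles tangent to L at distinct points x and y respectively, with x ≠ p and y ≠ p. If M and N have a common point lying on p̄, then M and N also have a common point outside p̄; in particular M ∩ N is not a nonempty subset of p̄. -/
open LaguerrePlane

namespace LaguerrePlane

variable {P : Type*} {L : LaguerrePlane P} {p q : P} {K : Set P} {σ : Equiv.Perm P}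

/-- Distinct points of a circle are nonparallel. -/
theorem eq_of_par {C : Set P} (hC : C ∈ L.Circles) {a b : P} (ha : a ∈ C) (hb : b ∈ C)
    (h : L.Par a b) : a = b :=
  (L.parPoint a C hC).unique ⟨L.par_equiv.refl a, ha⟩ ⟨h, hb⟩

theorem not_par_of_ne {C : Set P} (hC : C ∈ L.Circles) {a b : P} (ha : a ∈ C) (hb : b ∈ C)
    (h : a ≠ b) : ¬ L.Par a b :=
  fun hab => h (eq_of_par hC ha hb hab)

theorem eq_of_joining {A B : Set P} (hA : A ∈ L.Circles) (hB : B ∈ L.Circles) {a b c : P}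
    (hab : ¬ L.Par a b) (hbc : ¬ L.Par b c) (hac : ¬ L.Par a c)
    (hA' : a ∈ A ∧ b ∈ A ∧ c ∈ A) (hB' : a ∈ B ∧ b ∈ B ∧ c ∈ B) : A = B :=
  (L.joinCircle a b c hab hbc hac).unique ⟨hA, hA'⟩ ⟨hB, hB'⟩

/-- Two circles tangent to a third one at the same point and sharing a further point agree. -/
theorem eq_of_touching {C A B : Set P} (hC : C ∈ L.Circles) (hA : A ∈ L.Circles)
    (hB : B ∈ L.Circles) {a b : P} (hbA : b ∈ A) (hbB : b ∈ B) (hab : ¬ L.Par a b)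
    (hCA : C ∩ A = {a}) (hCB : C ∩ B = {a}) : A = B := by
  have haC : a ∈ C := (hCA.symm ▸ Set.mem_singleton a : a ∈ C ∩ A).1
  have hbC : b ∉ C := fun h => by
    have : b ∈ C ∩ A := ⟨h, hbA⟩
    rw [hCA, Set.mem_singleton_iff] at this
    exact hab (this ▸ L.par_equiv.refl _)
  exact (L.touching C hC a haC b hbC hab).unique ⟨hA, hbA, hCA⟩ ⟨hB, hbB, hCB⟩

theorem IsAut.image_mem (h : L.IsAut σ) {C : Set P} (hC : C ∈ L.Circles) :
    ⇑σ '' C ∈ L.Circles :=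
  (h.1 C).1 hC

theorem image_inter_singleton {A B : Set P} {a : P} (h : A ∩ B = {a}) :
    ⇑σ '' A ∩ ⇑σ '' B = {σ a} := by
  rw [← Set.image_inter σ.injective, h, Set.image_singleton]

theorem mem_image_of_apply {A : Set P} {a b : P} (ha : a ∈ A) (h : σ a = b) : b ∈ ⇑σ '' A :=
  ⟨a, ha, h⟩

theorem circle_of_mem_pencil (hK : K ∈ L.Circles) {C : Set P} (hC : C ∈ L.pencil p K) :
    C ∈ L.Circles := by
  rcases hC with rfl | hC
  exacts [hK, hC.1]

theorem mem_of_mem_pencil (hpK : p ∈ K) {C : Set P} (hC : C ∈ L.pencil p K) : p ∈ C := by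
  rcases hC with rfl | hC
  · exact hpK
  · exact (hC.2.symm ▸ Set.mem_singleton p : p ∈ C ∩ K).1

theorem pencil_eq_of_mem (hK : K ∈ L.Circles) (hpK : p ∈ K) {A B : Set P}
    (hA : A ∈ L.pencil p K) (hB : B ∈ L.pencil p K) {r : P} (hrA : r ∈ A) (hrB : r ∈ B)
    (hr : r ≠ p) : A = B := by
  have hpr : ¬ L.Par p r :=
    not_par_of_ne (circle_of_mem_pencil hK hA) (mem_of_mem_pencil hpK hA) hrA hr.symm
  have key : ∀ {D : Set P}, D ∩ K = {p} → r ∈ D → r ∉ K := fun hD hrD hrK =>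
    hr (Set.mem_singleton_iff.1 (hD.subset ⟨hrD, hrK⟩))
  rcases hA with rfl | ⟨hA, hAK⟩ <;> rcases hB with rfl | ⟨hB, hBK⟩
  · rfl
  · exact absurd hrA (key hBK hrB)
  · exact absurd hrB (key hAK hrA)
  · exact eq_of_touching hK hA hB hrA hrB hpr (by rwa [Set.inter_comm])
      (by rwa [Set.inter_comm])

theorem exists_mem_pencil (hK : K ∈ L.Circles) (hpK : p ∈ K) {w : P} (hw : ¬ L.Par p w) :
    ∃ C ∈ L.pencil p K, w ∈ C := by
  by_cases hwK : w ∈ K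
  · exact ⟨K, Set.mem_insert _ _, hwK⟩
  · obtain ⟨C, ⟨hC, hwC, hKC⟩, -⟩ := L.touching K hK p hpK w hwK hw
    exact ⟨C, Or.inr ⟨hC, by rwa [Set.inter_comm]⟩, hwC⟩

theorem notMem_of_tangent {C M : Set P} (hpC : p ∈ C) {x : P} (hMC : M ∩ C = {x})
    (hx : x ≠ p) : p ∉ M :=
  fun hpM => hx (Set.mem_singleton_iff.1 (hMC.subset ⟨hpM, hpC⟩)).symm

/-- An automorphism fixing `p̄` pointwise, a circle `C` through `p` and two further points of `C`
fixes the generators of these two points pointwise. -/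
theorem IsAut.apply_eq_of_par (hσ : L.IsAut σ) (hfix : ∀ q, L.Par p q → σ q = q) {C : Set P}
    (hC : C ∈ L.Circles) (hpC : p ∈ C) (hσC : ⇑σ '' C = C) {m n : P} (hm : m ∈ C) (hn : n ∈ C)
    (hσm : σ m = m) (hσn : σ n = n) (hmn : m ≠ n) (hnp : n ≠ p) {z : P} (hz : L.Par m z) :
    σ z = z := by
  by_cases hzC : z ∈ C
  · rw [← eq_of_par hC hm hzC hz, hσm]
  have hnz : ¬ L.Par n z := fun h =>
    hmn (eq_of_par hC hm hn (L.par_equiv.trans hz (L.par_equiv.symm h)))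
  obtain ⟨A, ⟨hA, hzA, hCA⟩, -⟩ := L.touching C hC n hn z hzC hnz
  obtain ⟨q, ⟨hpq, hqA⟩, -⟩ := L.parPoint p A hA
  have hnq : ¬ L.Par n q := fun h =>
    hnp (eq_of_par hC hn hpC (L.par_equiv.trans h (L.par_equiv.symm hpq)))
  have hσA : ⇑σ '' A = A := by
    refine eq_of_touching hC (hσ.image_mem hA) hA (mem_image_of_apply hqA (hfix q hpq)) hqA hnq
      ?_ hCA
    have := image_inter_singleton (σ := σ) hCA
    rwa [hσC, hσn] at this
  have hmz : L.Par m (σ z) := by simpa [hσm] using (hσ.2 m z).1 hz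
  exact eq_of_par hA (hσA ▸ Set.mem_image_of_mem σ hzA) hzA
    (L.par_equiv.trans (L.par_equiv.symm hmz) hz)

/-- An automorphism fixing `p̄` pointwise, a circle through `p` and two further points of it
fixes every circle. -/
theorem IsAut.image_eq (hσ : L.IsAut σ) (hfix : ∀ q, L.Par p q → σ q = q) {C : Set P}
    (hC : C ∈ L.Circles) (hpC : p ∈ C) (hσC : ⇑σ '' C = C) {m n : P} (hm : m ∈ C) (hn : n ∈ C)
    (hσm : σ m = m) (hσn : σ n = n) (hmn : m ≠ n) (hmp : m ≠ p) (hnp : n ≠ p) {F : Set P}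
    (hF : F ∈ L.Circles) : ⇑σ '' F = F := by
  obtain ⟨a, ⟨hma, haF⟩, -⟩ := L.parPoint m F hF
  obtain ⟨b, ⟨hnb, hbF⟩, -⟩ := L.parPoint n F hF
  obtain ⟨c, ⟨hpc, hcF⟩, -⟩ := L.parPoint p F hF
  have key : ∀ {u v s t : P}, u ∈ C → v ∈ C → u ≠ v → L.Par u s → L.Par v t → ¬ L.Par s t :=
    fun hu hv huv hus hvt hst => huv (eq_of_par hC hu hv
      (L.par_equiv.trans hus (L.par_equiv.trans hst (L.par_equiv.symm hvt))))
  refine eq_of_joining (hσ.image_mem hF) hF (key hm hn hmn hma hnb) (key hn hpC hnp hnb hpc)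
    (key hm hpC hmp hma hpc) ⟨mem_image_of_apply haF ?_, mem_image_of_apply hbF ?_,
      mem_image_of_apply hcF (hfix c hpc)⟩ ⟨haF, hbF, hcF⟩
  · exact hσ.apply_eq_of_par hfix hC hpC hσC hm hn hσm hσn hmn hnp hma
  · exact hσ.apply_eq_of_par hfix hC hpC hσC hn hm hσn hσm hmn.symm hmp hnb

/-- The group acts transitively on pairs of distinct points, other than `p`, of members of the
pencil. -/
theorem exists_apply_pair {Δ : Subgroup (Equiv.Perm P)} (hK : K ∈ L.Circles) (hpK : p ∈ K)
    (hfix : ∀ σ ∈ Δ, ∀ q, L.Par p q → σ q = q)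
    (hpen : ∀ σ ∈ Δ, ∀ M ∈ L.pencil p K, ⇑σ '' M ∈ L.pencil p K)
    (hA1 : ∀ x y : P, ¬ L.Par p x → ¬ L.Par p y → ∃ σ ∈ Δ, σ x = y)
    (hA2 : ∀ r ∈ K, r ≠ p → ∀ x ∈ K, x ≠ p → x ≠ r → ∀ y ∈ K, y ≠ p → y ≠ r →
      ∃ σ ∈ Δ, σ r = r ∧ σ x = y)
    {C D : Set P} (hC : C ∈ L.pencil p K) (hD : D ∈ L.pencil p K) {x y r s : P}
    (hx : x ∈ C) (hy : y ∈ C) (hr : r ∈ D) (hs : s ∈ D) (hxp : x ≠ p) (hyp : y ≠ p)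
    (hrp : r ≠ p) (hsp : s ≠ p) (hxy : x ≠ y) (hrs : r ≠ s) :
    ∃ τ ∈ Δ, τ x = r ∧ τ y = s := by
  have npar : ∀ {E : Set P}, E ∈ L.pencil p K → ∀ {u : P}, u ∈ E → u ≠ p → ¬ L.Par p u :=
    fun hE _ hu hup =>
      not_par_of_ne (circle_of_mem_pencil hK hE) (mem_of_mem_pencil hpK hE) hu hup.symm
  obtain ⟨k, ⟨hxk, hkK⟩, -⟩ := L.parPoint x K hK
  have hpk : ¬ L.Par p k := fun h =>
    npar hC hx hxp (L.par_equiv.trans h (L.par_equiv.symm hxk))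
  have hkp : k ≠ p := fun h => hpk (h ▸ L.par_equiv.refl _)
  have move : ∀ {E : Set P}, E ∈ L.pencil p K → ∀ {u v : P}, u ∈ E → v ∈ E → u ≠ p → v ≠ p →
      u ≠ v → ∃ σ ∈ Δ, σ u = k ∧ σ v ∈ K ∧ σ v ≠ p ∧ σ v ≠ k := by
    intro E hE u v hu hv hup hvp huv
    obtain ⟨σ, hσ, hσu⟩ := hA1 u k (npar hE hu hup) hpk
    have hσE : ⇑σ '' E = K := pencil_eq_of_mem hK hpK (hpen σ hσ E hE) (Set.mem_insert _ _)
      (mem_image_of_apply hu hσu) hkK hkp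
    refine ⟨σ, hσ, hσu, hσE ▸ Set.mem_image_of_mem σ hv, fun h => hvp ?_, fun h => huv ?_⟩
    · exact σ.injective (h.trans (hfix σ hσ p (L.par_equiv.refl p)).symm)
    · exact σ.injective (hσu.trans h.symm)
  obtain ⟨α, hα, hαx, hαK, hαp, hαk⟩ := move hC hx hy hxp hyp hxy
  obtain ⟨β, hβ, hβr, hβK, hβp, hβk⟩ := move hD hr hs hrp hsp hrs
  obtain ⟨γ, hγ, hγk, hγ'⟩ := hA2 k hkK hkp _ hαK hαp hαk _ hβK hβp hβk
  refine ⟨β⁻¹ * (γ * α), Δ.mul_mem (Δ.inv_mem hβ) (Δ.mul_mem hγ hα), ?_, ?_⟩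
  · rw [Equiv.Perm.mul_apply, Equiv.Perm.mul_apply, hαx, hγk, Equiv.Perm.inv_eq_iff_eq, hβr]
  · rw [Equiv.Perm.mul_apply, Equiv.Perm.mul_apply, hγ', Equiv.Perm.inv_eq_iff_eq]

/-- If two circles through `q ∈ p̄` tangent to a member of the pencil at `x` and `y` are tangent
at `q`, so are any two circles through `q` tangent to another member at distinct points. -/
theorem inter_eq_of_tangent_pair {C D M N A B : Set P} {x y r s : P}
    {τ : Equiv.Perm P} (hτ : L.IsAut τ) (hτq : τ q = q) (hτC : ⇑τ '' C = D)
    (hτx : τ x = r) (hτy : τ y = s) (hM : M ∈ L.Circles) (hN : N ∈ L.Circles)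
    (hA : A ∈ L.Circles) (hB : B ∈ L.Circles) (hD : D ∈ L.Circles)
    (hMC : M ∩ C = {x}) (hNC : N ∩ C = {y}) (hAD : A ∩ D = {r}) (hBD : B ∩ D = {s})
    (hqM : q ∈ M) (hqN : q ∈ N) (hqA : q ∈ A) (hqB : q ∈ B)
    (hrq : ¬ L.Par r q) (hsq : ¬ L.Par s q) (hMN : M ∩ N = {q}) : A ∩ B = {q} := by
  have key : ∀ {E F : Set P} {u v : P}, E ∈ L.Circles → F ∈ L.Circles → E ∩ C = {u} →
      F ∩ D = {v} → τ u = v → q ∈ E → q ∈ F → ¬ L.Par v q → ⇑τ '' E = F := by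
    intro E F u v hE hF hEC hFD huv hqE hqF hvq
    refine eq_of_touching hD (hτ.image_mem hE) hF (mem_image_of_apply hqE hτq) hqF hvq ?_
      (by rwa [Set.inter_comm])
    have := image_inter_singleton (σ := τ) hEC
    rwa [hτC, huv, Set.inter_comm] at this
  have := image_inter_singleton (σ := τ) hMN
  rwa [key hM hA hMC hAD hτx hqM hqA hrq, key hN hB hNC hBD hτy hqN hqB hsq, hτq] at this

end LaguerrePlane

/-- assume (A3).  If M, N are tangent to a circle C ∈ ⟨p,K⟩ at
distinct points x, y different from p and M, N have a common point on p̄, then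
they also have a common point outside p̄. -/
theorem no_tangency_on_generator
    {P : Type*} (L : LaguerrePlane P) (p : P) (K : Set P)
    (Δ : Subgroup (Equiv.Perm P))
    (hK : K ∈ L.Circles) (hpK : p ∈ K)
    (haut : ∀ σ ∈ Δ, L.IsAut σ)
    (hfix : ∀ σ ∈ Δ, ∀ q, L.Par p q → σ q = q)
    (hpen : ∀ σ ∈ Δ, ∀ M ∈ L.pencil p K, ⇑σ '' M ∈ L.pencil p K)
    (hA1 : ∀ x y : P, ¬ L.Par p x → ¬ L.Par p y → ∃ σ ∈ Δ, σ x = y)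
    (hA2 : ∀ r ∈ K, r ≠ p → ∀ x ∈ K, x ≠ p → x ≠ r → ∀ y ∈ K, y ≠ p → y ≠ r →
      ∃ σ ∈ Δ, σ r = r ∧ σ x = y)    (hA3 : ∀ M ∈ L.Circles, p ∉ M → ∃! N, N ∈ L.pencil p K ∧ ∃ z, M ∩ N = {z})    :
    ∀ C ∈ L.pencil p K, ∀ M ∈ L.Circles, ∀ N ∈ L.Circles, ∀ x y : P,
    x ≠ y → x ≠ p → y ≠ p → M ∩ C = {x} → N ∩ C = {y} →
    (∃ q ∈ M ∩ N, L.Par p q) → ∃ z ∈ M ∩ N, ¬ L.Par p z := by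
  intro C hC M hM N hN x y hxy hxp hyp hMC hNC ⟨q, ⟨hqM, hqN⟩, hpq⟩
  by_contra! hcon
  have hCc := circle_of_mem_pencil hK hC
  have hpC := mem_of_mem_pencil hpK hC
  have hxMC : x ∈ M ∩ C := hMC.symm ▸ Set.mem_singleton x
  have hyNC : y ∈ N ∩ C := hNC.symm ▸ Set.mem_singleton y
  have hpM := notMem_of_tangent hpC hMC hxp
  have hMN : M ∩ N = {q} := by
    refine Set.eq_singleton_iff_unique_mem.2 ⟨⟨hqM, hqN⟩, fun z hz => ?_⟩
    exact eq_of_par hM hz.1 hqM (L.par_equiv.trans (L.par_equiv.symm (hcon z hz)) hpq)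
  -- a second member `D` of the pencil meeting `M` in two points `w`, `w'`
  obtain ⟨w, ⟨hyw, hwM⟩, -⟩ := L.parPoint y M hM
  have hpw : ¬ L.Par p w := fun h =>
    hyp (eq_of_par hCc hyNC.2 hpC (L.par_equiv.trans hyw (L.par_equiv.symm h)))
  have hwx : w ≠ x := fun h =>
    hxy (eq_of_par hCc hyNC.2 hxMC.2 (h ▸ hyw)).symm
  obtain ⟨D, hD, hwD⟩ := exists_mem_pencil hK hpK hpw
  have hDc := circle_of_mem_pencil hK hD
  have hpD := mem_of_mem_pencil hpK hD
  have hDC : D ≠ C := by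
    rintro rfl
    exact hwx (Set.mem_singleton_iff.1 (hMC.subset ⟨hwM, hwD⟩))
  have unique_tangent : ∀ E ∈ L.pencil p K, ∀ z, M ∩ E = {z} → E = C := fun E hE z hz =>
    (hA3 M hM hpM).unique ⟨hE, z, hz⟩ ⟨hC, x, hMC⟩
  obtain ⟨w', ⟨hw'M, hw'D⟩, hw'⟩ : ∃ w' ∈ M ∩ D, w' ≠ w := by
    by_contra! h
    exact hDC (unique_tangent D hD w (Set.eq_singleton_iff_unique_mem.2 ⟨⟨hwM, hwD⟩, h⟩))
  have hwp : w ≠ p := fun h => hpM (h ▸ hwM)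
  have hw'p : w' ≠ p := fun h => hpM (h ▸ hw'M)
  have nparq : ∀ {u : P}, u ∈ D → u ≠ p → ¬ L.Par u q := fun hu hup h =>
    hup (eq_of_par hDc hu hpD (L.par_equiv.trans h (L.par_equiv.symm hpq)))
  have hqD : q ∉ D := fun h => hpM ((eq_of_par hDc hpD h hpq) ▸ hqM)
  -- the element of `Δ` interchanging `w` and `w'`
  obtain ⟨σ, hσΔ, hσw, hσw'⟩ := exists_apply_pair hK hpK hfix hpen hA1 hA2 hD hD hwD hw'D hw'D hwD
    hwp hw'p hw'p hwp hw'.symm hw'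
  have hσ := haut σ hσΔ
  have hσq : σ q = q := hfix σ hσΔ q hpq
  have hσD : ⇑σ '' D = D := pencil_eq_of_mem hK hpK (hpen σ hσΔ D hD) hD
    (mem_image_of_apply hw'D hσw') hwD hwp
  have hσM : ⇑σ '' M = M := eq_of_joining (hσ.image_mem hM) hM
    (not_par_of_ne hM hwM hw'M hw'.symm) (nparq hw'D hw'p) (nparq hwD hwp)
    ⟨mem_image_of_apply hw'M hσw', mem_image_of_apply hwM hσw, mem_image_of_apply hqM hσq⟩
    ⟨hwM, hw'M, hqM⟩
  have hσx : σ x = x := by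
    have h := image_inter_singleton (σ := σ) hMC
    rw [hσM] at h
    rw [unique_tangent _ (hpen σ hσΔ C hC) _ h, hMC] at h
    exact (Set.singleton_injective h).symm
  obtain ⟨m, ⟨hxm, hmD⟩, -⟩ := L.parPoint x D hDc
  have hmp : m ≠ p := fun h => hxp (eq_of_par hCc hxMC.2 hpC (h ▸ hxm))
  have hmM : m ∉ M := fun h => by
    have hxm' : x = m := eq_of_par hM hxMC.1 h hxm
    exact hDC (pencil_eq_of_mem hK hpK hD hC hmD (hxm' ▸ hxMC.2) hmp)
  have hσm : σ m = m := by
    have h : L.Par x (σ m) := by simpa [hσx] using (hσ.2 x m).1 hxm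
    exact eq_of_par hDc (hσD ▸ Set.mem_image_of_mem σ hmD) hmD
      (L.par_equiv.trans (L.par_equiv.symm h) hxm)
  have hqm : ¬ L.Par q m := fun h => nparq hmD hmp (L.par_equiv.symm h)
  have hmw : m ≠ w := fun h => hmM (h ▸ hwM)
  obtain ⟨F, ⟨hF, hqF, hDF⟩, -⟩ := L.touching D hDc w hwD q hqD (nparq hwD hwp)
  have hwF : w ∈ D ∩ F := hDF.symm ▸ Set.mem_singleton w
  obtain ⟨E, ⟨hE, hmE, hME⟩, -⟩ := L.touching M hM q hqM m hmM hqm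
  have hqE : q ∈ M ∩ E := hME.symm ▸ Set.mem_singleton q
  have hpE : p ∉ E := fun h => hpM ((eq_of_par hE h hqE.2 hpq) ▸ hqM)
  have hσE : ⇑σ '' E = E := by
    refine eq_of_touching hM (hσ.image_mem hE) hE (mem_image_of_apply hmE hσm) hmE hqm ?_ hME
    have h := image_inter_singleton (σ := σ) hME
    rwa [hσM, hσq] at h
  -- `E` is not tangent to `D`, since otherwise `E`, `F` and hence `F`, `M` would be tangent at `q`
  obtain ⟨m', ⟨hm'E, hm'D⟩, hm'⟩ : ∃ m' ∈ E ∩ D, m' ≠ m := by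
    by_contra! h
    have hED : E ∩ D = {m} := Set.eq_singleton_iff_unique_mem.2 ⟨⟨hmE, hmD⟩, h⟩
    obtain ⟨τ, hτ, hτx, hτy⟩ := exists_apply_pair hK hpK hfix hpen hA1 hA2 hC hD hxMC.2 hyNC.2
      hmD hwD hxp hyp hmp hwp hxy hmw
    have hτC : ⇑τ '' C = D := pencil_eq_of_mem hK hpK (hpen τ hτ C hC) hD
      (mem_image_of_apply hxMC.2 hτx) hmD hmp
    have hEF : E ∩ F = {q} := inter_eq_of_tangent_pair (haut τ hτ) (hfix τ hτ q hpq) hτC hτx hτy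
      hM hN hE hF hDc hMC hNC hED (by rwa [Set.inter_comm]) hqM hqN hqE.2 hqF
      (nparq hmD hmp) (nparq hwD hwp) hMN
    have hMF : M = F := eq_of_touching hE hM hF hwM hwF.2
      (fun h => nparq hwD hwp (L.par_equiv.symm h)) (by rwa [Set.inter_comm]) hEF
    exact hDC (unique_tangent D hD w (by rw [hMF, Set.inter_comm, hDF]))
  have hm'p : m' ≠ p := fun h => hpE (h ▸ hm'E)
  have hσm' : σ m' = m' := by
    by_contra hne
    have hE' : σ m' ∈ E := hσE ▸ Set.mem_image_of_mem σ hm'E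
    have hD' : σ m' ∈ D := hσD ▸ Set.mem_image_of_mem σ hm'D
    have hne' : σ m' ≠ m := fun h => hm' (σ.injective (h.trans hσm.symm))
    have hED : E = D := eq_of_joining hE hDc (not_par_of_ne hE hmE hm'E hm'.symm)
      (not_par_of_ne hE hm'E hE' (Ne.symm hne)) (not_par_of_ne hE hmE hE' hne'.symm)
      ⟨hmE, hm'E, hE'⟩ ⟨hmD, hm'D, hD'⟩
    exact hpE (hED ▸ hpD)
  have hσF : ⇑σ '' F = F := hσ.image_eq (hfix σ hσΔ) hDc hpD hσD hmD hm'D hσm hσm' hm'.symm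
    hmp hm'p hF
  have hw'F : w' ∈ D ∩ F := ⟨hw'D, hσF ▸ mem_image_of_apply hwF.2 hσw⟩
  rw [hDF] at hw'F
  exact hw' hw'F
end
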